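/- arXiv:1411.0476 — 3 statements merged into one kernel-verified Lean document; each statement's English description precedes it below -/
import Mathlib

section
/- (Bilinear identity A.3.) For all smooth functions f, g : ℝ² → ℝ of (n, x), every real h, and every point (n, x): D_x[(D_x e^{(h/2)D_n} f·g)·(e^{−(h/2)D_n} f·g)] + D_x[(e^{(h/2)D_n} f·g)·(D_x e^{−(h/2)D_n} f·g)] = 2·sinh((h/2)D_n)[(D_x² f·g)·(f g)], where the sinh-shift operator on the right acts on the pair of functions (n, x) ↦ (D_x² f·g)(n, x) and (n, x) ↦ f(n, x)g(n, x). -/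
/-- Hirota bilinear operator `D_x^a e^{δ D_n}` applied to a pair of functions
of `(n, x)`, evaluated at `(n, x)`. -/
noncomputable def hirota2 (a : ℕ) (δ : ℝ) (A B : ℝ → ℝ → ℝ) (n x : ℝ) : ℝ :=
  iteratedDeriv a (fun r => A (n + δ) (x + r) * B (n - δ) (x - r)) 0

theorem hirota2_zero (δ : ℝ) (A B : ℝ → ℝ → ℝ) (n x : ℝ) :
    hirota2 0 δ A B n x = A (n + δ) x * B (n - δ) x := by
  simp [hirota2]

theorem hasDerivAt_hirota_product {u v u' v' : ℝ → ℝ} {x r : ℝ}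
    (hu : HasDerivAt u (u' (x + r)) (x + r)) (hv : HasDerivAt v (v' (x - r)) (x - r)) :
    HasDerivAt (fun s => u (x + s) * v (x - s))
      (u' (x + r) * v (x - r) - u (x + r) * v' (x - r)) r := by
  refine ((hu.comp_const_add x r).mul (hv.comp_const_sub x r)).congr_deriv ?_
  ring

theorem hirota2_one {δ : ℝ} {A B : ℝ → ℝ → ℝ} {n x a b : ℝ}
    (hA : HasDerivAt (A (n + δ)) a x) (hB : HasDerivAt (B (n - δ)) b x) :
    hirota2 1 δ A B n x = a * B (n - δ) x - A (n + δ) x * b := by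
  have key := hasDerivAt_hirota_product (u' := fun _ => a) (v' := fun _ => b) (x := x) (r := 0)
    (by simpa using hA) (by simpa using hB)
  simpa [hirota2, iteratedDeriv_one] using key.deriv

theorem hirota2_two {δ : ℝ} {A B : ℝ → ℝ → ℝ} {n : ℝ} {a b a' b' : ℝ → ℝ}
    (hA : ∀ y, HasDerivAt (A (n + δ)) (a y) y) (hB : ∀ y, HasDerivAt (B (n - δ)) (b y) y)
    (ha : ∀ y, HasDerivAt a (a' y) y) (hb : ∀ y, HasDerivAt b (b' y) y) (x : ℝ) :
    hirota2 2 δ A B n x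
      = a' x * B (n - δ) x - 2 * (a x * b x) + A (n + δ) x * b' x := by
  have first : deriv (fun r => A (n + δ) (x + r) * B (n - δ) (x - r))
      = fun r => a (x + r) * B (n - δ) (x - r) - A (n + δ) (x + r) * b (x - r) :=
    funext fun r => (hasDerivAt_hirota_product (hA _) (hB _)).deriv
  have second := (hasDerivAt_hirota_product (x := x) (r := 0) (ha _) (hB _)).sub
    (hasDerivAt_hirota_product (x := x) (r := 0) (hA _) (hb _))
  rw [hirota2, iteratedDeriv_succ, iteratedDeriv_one, first]
  refine second.deriv.trans ?_
  simp only [add_zero, sub_zero]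
  ring

theorem contDiff_slice {f : ℝ → ℝ → ℝ}
    (hf : ContDiff ℝ (⊤ : ℕ∞) (fun pt : ℝ × ℝ => f pt.1 pt.2)) (n : ℝ) :
    ContDiff ℝ (⊤ : ℕ∞) (f n) :=
  hf.comp (contDiff_const.prodMk contDiff_id)

theorem hasDerivAt_slice {f : ℝ → ℝ → ℝ}
    (hf : ContDiff ℝ (⊤ : ℕ∞) (fun pt : ℝ × ℝ => f pt.1 pt.2)) (n y : ℝ) :
    HasDerivAt (f n) (deriv (f n) y) y :=
  ((contDiff_slice hf n).differentiable (by simp) y).hasDerivAt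

theorem hasDerivAt_deriv_slice {f : ℝ → ℝ → ℝ}
    (hf : ContDiff ℝ (⊤ : ℕ∞) (fun pt : ℝ × ℝ => f pt.1 pt.2)) (n y : ℝ) :
    HasDerivAt (deriv (f n)) (deriv (deriv (f n)) y) y :=
  ((contDiff_infty_iff_deriv.1 (contDiff_slice hf n)).2.differentiable (by simp) y).hasDerivAt

/-- Bilinear identity (A.3). -/
theorem bilinear_identity_A3
    (f g : ℝ → ℝ → ℝ)
    (hf : ContDiff ℝ (⊤ : ℕ∞) (fun pt : ℝ × ℝ => f pt.1 pt.2))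
    (hg : ContDiff ℝ (⊤ : ℕ∞) (fun pt : ℝ × ℝ => g pt.1 pt.2))
    (h n x : ℝ) :
    hirota2 1 0 (hirota2 1 (h/2) f g) (hirota2 0 (-(h/2)) f g) n x
        + hirota2 1 0 (hirota2 0 (h/2) f g) (hirota2 1 (-(h/2)) f g) n x
      = hirota2 0 (h/2) (hirota2 2 0 f g) (fun n' x' => f n' x' * g n' x') n x
        - hirota2 0 (-(h/2)) (hirota2 2 0 f g) (fun n' x' => f n' x' * g n' x') n x := by
  have shift (δ m : ℝ) : HasDerivAt (hirota2 0 δ f g m)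
      (deriv (f (m + δ)) x * g (m - δ) x + f (m + δ) x * deriv (g (m - δ)) x) x := by
    rw [funext (hirota2_zero δ f g m)]
    exact (hasDerivAt_slice hf _ x).mul (hasDerivAt_slice hg _ x)
  have one (δ m y : ℝ) : hirota2 1 δ f g m y
      = deriv (f (m + δ)) y * g (m - δ) y - f (m + δ) y * deriv (g (m - δ)) y :=
    hirota2_one (hasDerivAt_slice hf _ y) (hasDerivAt_slice hg _ y)
  have shift_one (δ m : ℝ) : HasDerivAt (hirota2 1 δ f g m)
      (deriv (deriv (f (m + δ))) x * g (m - δ) x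
        - f (m + δ) x * deriv (deriv (g (m - δ))) x) x := by
    rw [funext (one δ m)]
    refine (((hasDerivAt_deriv_slice hf _ x).mul (hasDerivAt_slice hg _ x)).sub
      ((hasDerivAt_slice hf _ x).mul (hasDerivAt_deriv_slice hg _ x))).congr_deriv ?_
    ring
  have two (m : ℝ) := hirota2_two (δ := 0) (n := m) (hasDerivAt_slice hf _)
    (hasDerivAt_slice hg _) (hasDerivAt_deriv_slice hf _) (hasDerivAt_deriv_slice hg _) x
  rw [hirota2_one (shift_one _ _) (shift _ _), hirota2_one (shift _ _) (shift_one _ _)]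
  simp only [hirota2_zero, one, two, add_zero, sub_zero, sub_neg_eq_add, ← sub_eq_add_neg]
  ring
end

section
/- (Bilinear identity A.6.) For all smooth functions f, g : ℝ² → ℝ of (n, x), every real h, and every point (n, x): (D_x³ e^{(h/2)D_n} f·f)(e^{(h/2)D_n} g·g) − (e^{(h/2)D_n} f·f)(D_x³ e^{(h/2)D_n} g·g) = 2·sinh((h/2)D_n)[(D_x³ f·g)·(f g)] − 3 D_x[(D_x e^{(h/2)D_n} f·g)·(D_x e^{−(h/2)D_n} f·g)]. -/
lemma ContDiff.differentiable_deriv_iterate {u : ℝ → ℝ} (hu : ContDiff ℝ (⊤ : ℕ∞) u) (k : ℕ) :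
    Differentiable ℝ (deriv^[k] u) :=
  (hu.iterate_deriv k).differentiable (by simp)

lemma hasDerivAt_mul_reflect {u v : ℝ → ℝ} (hu : Differentiable ℝ u) (hv : Differentiable ℝ v)
    (x r : ℝ) :
    HasDerivAt (fun r => u (x + r) * v (x - r))
      (deriv u (x + r) * v (x - r) - u (x + r) * deriv v (x - r)) r := by
  have h1 : HasDerivAt (fun r => u (x + r)) (deriv u (x + r)) r :=
    (hu (x + r)).hasDerivAt.comp_const_add x r
  have h2 : HasDerivAt (fun r => v (x - r)) (-deriv v (x - r)) r :=
    (hv (x - r)).hasDerivAt.comp_const_sub x r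
  exact (h1.fun_mul h2).congr_deriv (by ring)

lemma iteratedDeriv_one_mul_reflect {u v : ℝ → ℝ} (hu : Differentiable ℝ u)
    (hv : Differentiable ℝ v) (x : ℝ) :
    iteratedDeriv 1 (fun r => u (x + r) * v (x - r)) 0 = deriv u x * v x - u x * deriv v x := by
  rw [iteratedDeriv_one, (hasDerivAt_mul_reflect hu hv x 0).deriv]
  simp

lemma iteratedDeriv_three_mul_reflect {u v : ℝ → ℝ} (hu : ContDiff ℝ (⊤ : ℕ∞) u)
    (hv : ContDiff ℝ (⊤ : ℕ∞) v) (x : ℝ) :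
    iteratedDeriv 3 (fun r => u (x + r) * v (x - r)) 0 =
      deriv^[3] u x * v x - 3 * (deriv^[2] u x * deriv v x) + 3 * (deriv u x * deriv^[2] v x)
        - u x * deriv^[3] v x := by
  have key (i j : ℕ) (r : ℝ) := hasDerivAt_mul_reflect (hu.differentiable_deriv_iterate i)
    (hv.differentiable_deriv_iterate j) x r
  simp only [← Function.iterate_succ_apply' deriv] at key
  have e1 : deriv (fun r => u (x + r) * v (x - r)) =
      fun r => deriv^[1] u (x + r) * deriv^[0] v (x - r)
        - deriv^[0] u (x + r) * deriv^[1] v (x - r) :=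
    funext fun r => (key 0 0 r).deriv
  have e2 : deriv (fun r => deriv^[1] u (x + r) * deriv^[0] v (x - r)
        - deriv^[0] u (x + r) * deriv^[1] v (x - r)) =
      fun r => (deriv^[2] u (x + r) * deriv^[0] v (x - r)
          - deriv^[1] u (x + r) * deriv^[1] v (x - r))
        - (deriv^[1] u (x + r) * deriv^[1] v (x - r)
          - deriv^[0] u (x + r) * deriv^[2] v (x - r)) :=
    funext fun r => ((key 1 0 r).fun_sub (key 0 1 r)).deriv
  rw [iteratedDeriv_succ', iteratedDeriv_succ', iteratedDeriv_one, e1, e2,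
    (((key 2 0 0).fun_sub (key 1 1 0)).fun_sub ((key 1 1 0).fun_sub (key 0 2 0))).deriv]
  simp only [add_zero, sub_zero, Function.iterate_zero, id, Function.iterate_succ,
    Function.comp_apply]
  ring

lemma hasDerivAt_wronskian {u v : ℝ → ℝ} (hu : ContDiff ℝ (⊤ : ℕ∞) u)
    (hv : ContDiff ℝ (⊤ : ℕ∞) v) (x : ℝ) :
    HasDerivAt (fun y => deriv u y * v y - u y * deriv v y)
      (deriv^[2] u x * v x - u x * deriv^[2] v x) x := by
  have hu0 := (hu.differentiable_deriv_iterate 0 x).hasDerivAt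
  have hu1 := (hu.differentiable_deriv_iterate 1 x).hasDerivAt
  have hv0 := (hv.differentiable_deriv_iterate 0 x).hasDerivAt
  have hv1 := (hv.differentiable_deriv_iterate 1 x).hasDerivAt
  refine ((hu1.fun_mul hv0).fun_sub (hu0.fun_mul hv1)).congr_deriv ?_
  simp only [Function.iterate_zero, id, Function.iterate_succ, Function.comp_apply]
  ring

/-- Bilinear identity (A.6). -/
theorem bilinear_identity_A6
    (f g : ℝ → ℝ → ℝ)
    (hf : ContDiff ℝ (⊤ : ℕ∞) (fun pt : ℝ × ℝ => f pt.1 pt.2))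
    (hg : ContDiff ℝ (⊤ : ℕ∞) (fun pt : ℝ × ℝ => g pt.1 pt.2))
    (h n x : ℝ) :
    hirota2 3 (h/2) f f n x * hirota2 0 (h/2) g g n x
        - hirota2 0 (h/2) f f n x * hirota2 3 (h/2) g g n x
      = (hirota2 0 (h/2) (hirota2 3 0 f g) (fun n' x' => f n' x' * g n' x') n x
          - hirota2 0 (-(h/2)) (hirota2 3 0 f g) (fun n' x' => f n' x' * g n' x') n x)
        - 3 * hirota2 1 0 (hirota2 1 (h/2) f g) (hirota2 1 (-(h/2)) f g) n x := by
  have sf (m : ℝ) : ContDiff ℝ (⊤ : ℕ∞) (f m) := hf.comp (contDiff_prodMk_right m)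
  have sg (m : ℝ) : ContDiff ℝ (⊤ : ℕ∞) (g m) := hg.comp (contDiff_prodMk_right m)
  have df (m : ℝ) : Differentiable ℝ (f m) := (sf m).differentiable (by simp)
  have dg (m : ℝ) : Differentiable ℝ (g m) := (sg m).differentiable (by simp)
  have hone (δ : ℝ) : hirota2 1 δ f g n = fun y =>
      deriv (f (n + δ)) y * g (n - δ) y - f (n + δ) y * deriv (g (n - δ)) y :=
    funext fun y => iteratedDeriv_one_mul_reflect (df _) (dg _) y
  have dW (δ : ℝ) (y : ℝ) := hasDerivAt_wronskian (sf (n + δ)) (sg (n - δ)) y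
  have dW' (δ : ℝ) : Differentiable ℝ (hirota2 1 δ f g n) := by
    rw [hone]
    exact fun y => (dW δ y).differentiableAt
  have houter : hirota2 1 0 (hirota2 1 (h/2) f g) (hirota2 1 (-(h/2)) f g) n x =
      deriv (hirota2 1 (h/2) f g n) x * hirota2 1 (-(h/2)) f g n x
        - hirota2 1 (h/2) f g n x * deriv (hirota2 1 (-(h/2)) f g n) x := by
    rw [← iteratedDeriv_one_mul_reflect (dW' _) (dW' _)]
    conv_lhs => rw [hirota2, add_zero, sub_zero]
  rw [houter, hone, hone, (dW _ x).deriv, (dW _ x).deriv]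
  simp only [hirota2, iteratedDeriv_zero, add_zero, sub_zero, sub_neg_eq_add, ← sub_eq_add_neg,
    iteratedDeriv_three_mul_reflect (sf _) (sf _), iteratedDeriv_three_mul_reflect (sg _) (sg _),
    iteratedDeriv_three_mul_reflect (sf _) (sg _)]
  ring
end

section
/- (Bilinear identity A.12.) For all smooth functions f, g : ℝ² → ℝ of (n, x), every real h, and every point (n, x): (D_x⁴ e^{(h/2)D_n} f·f)(e^{(h/2)D_n} g·g) − (e^{(h/2)D_n} f·f)(D_x⁴ e^{(h/2)D_n} g·g) = D_x[(D_x³ e^{(h/2)D_n} f·g)·(e^{−(h/2)D_n} f·g)] − D_x[(e^{(h/2)D_n} f·g)·(D_x³ e^{−(h/2)D_n} f·g)] − 3 D_x[(D_x² e^{(h/2)D_n} f·g)·(D_x e^{−(h/2)D_n} f·g)] + 3 D_x[(D_x e^{(h/2)D_n} f·g)·(D_x² e^{−(h/2)D_n} f·g)] − 2[(D_x³ e^{(h/2)D_n} f·f)(D_x e^{(h/2)D_n} g·g) − (D_x e^{(h/2)D_n} f·f)(D_x³ e^{(h/2)D_n} g·g)]. -/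
/-- Leibniz expansion of `D_x^a e^{δ D_n}` in terms of the `x`-derivatives of the two factors. -/
theorem hirota2_eq_sum (a : ℕ) (δ : ℝ) {A B : ℝ → ℝ → ℝ} {n : ℝ}
    (hA : ContDiff ℝ (⊤ : ℕ∞) (A (n + δ))) (hB : ContDiff ℝ (⊤ : ℕ∞) (B (n - δ))) (x : ℝ) :
    hirota2 a δ A B n x = ∑ i ∈ Finset.range (a + 1), (a.choose i : ℝ) *
      iteratedDeriv i (A (n + δ)) x * ((-1) ^ (a - i) * iteratedDeriv (a - i) (B (n - δ)) x) := by
  have hA' : ContDiff ℝ a fun r => A (n + δ) (x + r) :=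
    (hA.of_le (by exact_mod_cast le_top)).comp (contDiff_const.add contDiff_id)
  have hB' : ContDiff ℝ a fun r => B (n - δ) (x - r) :=
    (hB.of_le (by exact_mod_cast le_top)).comp (contDiff_const.sub contDiff_id)
  rw [hirota2, iteratedDeriv_fun_mul hA'.contDiffAt hB'.contDiffAt]
  simp [iteratedDeriv_comp_const_add, iteratedDeriv_comp_const_sub]

theorem hasDerivAt_hirota2 (a : ℕ) (δ : ℝ) {A B : ℝ → ℝ → ℝ} {n : ℝ}
    (hA : ContDiff ℝ (⊤ : ℕ∞) (A (n + δ))) (hB : ContDiff ℝ (⊤ : ℕ∞) (B (n - δ))) (x : ℝ) :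
    HasDerivAt (hirota2 a δ A B n) (∑ i ∈ Finset.range (a + 1), ((a.choose i : ℝ) *
      iteratedDeriv (i + 1) (A (n + δ)) x * ((-1) ^ (a - i) * iteratedDeriv (a - i) (B (n - δ)) x)
      + (a.choose i : ℝ) * iteratedDeriv i (A (n + δ)) x *
        ((-1) ^ (a - i) * iteratedDeriv (a - i + 1) (B (n - δ)) x))) x := by
  have key {u : ℝ → ℝ} (hu : ContDiff ℝ (⊤ : ℕ∞) u) (k : ℕ) :
      HasDerivAt (iteratedDeriv k u) (iteratedDeriv (k + 1) u x) x := by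
    rw [iteratedDeriv_succ]
    exact (hu.differentiable_iteratedDeriv k (by exact_mod_cast ENat.natCast_lt_top k) x).hasDerivAt
  rw [funext (hirota2_eq_sum a δ hA hB)]
  exact HasDerivAt.fun_sum fun i _ => ((key hA i).const_mul _).mul ((key hB (a - i)).const_mul _)

theorem hirota2_one_zero {P Q : ℝ → ℝ → ℝ} {n x p q : ℝ}
    (hP : HasDerivAt (P n) p x) (hQ : HasDerivAt (Q n) q x) :
    hirota2 1 0 P Q n x = p * Q n x - P n x * q := by
  have hP' : HasDerivAt (fun r => P n (x + r)) p 0 :=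
    HasDerivAt.comp_const_add x 0 (by simpa using hP)
  have hQ' : HasDerivAt (fun r => Q n (x - r)) (-q) 0 :=
    HasDerivAt.comp_const_sub x 0 (by simpa using hQ)
  simpa [hirota2, iteratedDeriv_one, sub_eq_add_neg] using (hP'.fun_mul hQ').deriv

/-- Bilinear identity (A.12). -/
theorem bilinear_identity_A12
    (f g : ℝ → ℝ → ℝ)
    (hf : ContDiff ℝ (⊤ : ℕ∞) (fun pt : ℝ × ℝ => f pt.1 pt.2))
    (hg : ContDiff ℝ (⊤ : ℕ∞) (fun pt : ℝ × ℝ => g pt.1 pt.2))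
    (h n x : ℝ) :
    hirota2 4 (h/2) f f n x * hirota2 0 (h/2) g g n x
        - hirota2 0 (h/2) f f n x * hirota2 4 (h/2) g g n x
      = hirota2 1 0 (hirota2 3 (h/2) f g) (hirota2 0 (-(h/2)) f g) n x
        - hirota2 1 0 (hirota2 0 (h/2) f g) (hirota2 3 (-(h/2)) f g) n x
        - 3 * hirota2 1 0 (hirota2 2 (h/2) f g) (hirota2 1 (-(h/2)) f g) n x
        + 3 * hirota2 1 0 (hirota2 1 (h/2) f g) (hirota2 2 (-(h/2)) f g) n x
        - 2 * (hirota2 3 (h/2) f f n x * hirota2 1 (h/2) g g n x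
          - hirota2 1 (h/2) f f n x * hirota2 3 (h/2) g g n x) := by
  have sf (m : ℝ) : ContDiff ℝ (⊤ : ℕ∞) (f m) := hf.comp (contDiff_const.prodMk contDiff_id)
  have sg (m : ℝ) : ContDiff ℝ (⊤ : ℕ∞) (g m) := hg.comp (contDiff_const.prodMk contDiff_id)
  have outer (a b : ℕ) (δ ε : ℝ) :=
    hirota2_one_zero (hasDerivAt_hirota2 a δ (sf (n + δ)) (sg (n - δ)) x)
      (hasDerivAt_hirota2 b ε (sf (n + ε)) (sg (n - ε)) x)
  simp only [outer, hirota2_eq_sum _ _ (sf _) (sf _), hirota2_eq_sum _ _ (sf _) (sg _),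
    hirota2_eq_sum _ _ (sg _) (sg _), Finset.sum_range_succ, Finset.sum_range_zero, sub_neg_eq_add,
    ← sub_eq_add_neg]
  norm_num [Nat.choose]
  ring
end
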